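/- arXiv:1707.03600 — 7 statements merged into one kernel-verified Lean document; each statement's English description precedes it below -/
import Mathlib

section
/- For every real ε with 0 < ε < 1/2, there exists an integer δ₀ such that every tournament T with minimum out-degree δ⁺(T) ≥ δ₀ admits a bisection (A, B) of its vertex set such that for every vertex v of T, both d_A⁺(v) ≥ (1/2 − ε)·d_T⁺(v) and d_B⁺(v) ≥ (1/2 − ε)·d_T⁺(v). -/
open Finset

/-- Out-degree of `v` in the digraph `D`. -/
def outDeg {V : Type*} [Fintype V] (D : V → V → Prop) [DecidableRel D] (v : V) : ℕ :=
  (Finset.univ.filter (fun w => D v w)).card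

/-- Number of out-neighbors of `v` lying in the set `S`. -/
def outDegIn {V : Type*} [Fintype V] (D : V → V → Prop) [DecidableRel D]
    (S : Finset V) (v : V) : ℕ :=
  (S.filter (fun w => D v w)).card

/-- A tournament: an irreflexive digraph in which every pair of distinct vertices is
joined by exactly one arc. -/
def IsTournament {V : Type*} (D : V → V → Prop) : Prop :=
  (∀ v, ¬ D v v) ∧ ∀ u v, u ≠ v → (D u v ↔ ¬ D v u)

/-- In a tournament, at most `2 * d + 1` vertices have out-degree exactly `d`. -/
theorem IsTournament.card_outDeg_eq_le {V : Type*} [Fintype V] [DecidableEq V]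
    {T : V → V → Prop} [DecidableRel T] (hT : IsTournament T) (d : ℕ) :
    #{v | outDeg T v = d} ≤ 2 * d + 1 := by
  set S : Finset V := {v | outDeg T v = d} with hS
  have hle : ∑ u ∈ S, ∑ w ∈ S, (if T u w then 1 else 0) ≤ #S * d := by
    rw [← smul_eq_mul]
    refine sum_le_card_nsmul _ _ _ fun u hu => ?_
    have hu' : outDeg T u = d := by simpa [hS] using hu
    rw [← card_filter, ← hu']
    exact card_le_card (filter_subset_filter _ (subset_univ _))
  have hcount : #S * #S = ∑ u ∈ S, ∑ w ∈ S, (if T u w then 1 else 0) +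
      ∑ u ∈ S, ∑ w ∈ S, (if T w u then 1 else 0) + #S := by
    have hdiag : #S = ∑ u ∈ S, ∑ w ∈ S, (if u = w then 1 else 0) := by simp
    conv_rhs => rw [hdiag]
    rw [← sum_add_distrib, ← sum_add_distrib, ← smul_eq_mul]
    refine (sum_eq_card_nsmul fun u _ => ?_).symm
    rw [← sum_add_distrib, ← sum_add_distrib, card_eq_sum_ones]
    refine sum_congr rfl fun w _ => ?_
    by_cases h : u = w
    · subst h
      simp [hT.1 u]
    · have := hT.2 u w h
      by_cases h' : T w u <;> simp_all
  rw [sum_comm (f := fun u w => if T w u then 1 else 0)] at hcount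
  by_contra! hlt
  nlinarith

/-- If the elements of `F` carry signs such that distinct elements have opposite signs, then the
square of the sum of the signs is at most the number of elements. -/
theorem sq_sum_units_le_card {V : Type*} [DecidableEq V] (F : Finset V) (c : V → ℤˣ)
    (hc : ∀ u ∈ F, ∀ v ∈ F, u ≠ v → c u = -c v) :
    (∑ v ∈ F, ((c v : ℤ) : ℝ)) ^ 2 ≤ #F := by
  have hrow : ∀ u ∈ F, ∑ v ∈ F, ((c u : ℤ) : ℝ) * ((c v : ℤ) : ℝ) ≤ 1 := by
    intro u hu
    rw [← add_sum_erase _ _ hu]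
    have h1 : ((c u : ℤ) : ℝ) * ((c u : ℤ) : ℝ) = 1 := by
      rcases Int.units_eq_one_or (c u) with h | h <;> simp [h]
    have h2 : ∑ v ∈ F.erase u, ((c u : ℤ) : ℝ) * ((c v : ℤ) : ℝ) ≤ 0 := by
      refine sum_nonpos fun v hv => ?_
      rw [mem_erase] at hv
      rw [hc v hv.2 u hu hv.1]
      push_cast
      linarith
    linarith
  rw [sq, sum_mul_sum]
  simpa using sum_le_card_nsmul F _ 1 hrow

/-- Bound on the moment generating function of a weighted sum of independent random signs. -/
theorem sum_exp_units_le {ι : Type*} [Fintype ι] [DecidableEq ι] (a : ι → ℝ) (t : ℝ) :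
    ∑ s : ι → ℤˣ, Real.exp (t * ∑ i, a i * ((s i : ℤ) : ℝ)) ≤
      2 ^ Fintype.card ι * Real.exp (t ^ 2 / 2 * ∑ i, a i ^ 2) := by
  have hprod : ∑ s : ι → ℤˣ, Real.exp (t * ∑ i, a i * ((s i : ℤ) : ℝ)) =
      ∏ i, ∑ x : ℤˣ, Real.exp (t * (a i * ((x : ℤ) : ℝ))) := by
    rw [prod_univ_sum, Fintype.piFinset_univ]
    simp_rw [mul_sum, Real.exp_sum]
  rw [hprod, mul_sum, Real.exp_sum, ← card_univ, ← prod_const, ← prod_mul_distrib]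
  refine prod_le_prod (fun i _ => sum_nonneg fun x _ => (Real.exp_pos _).le) fun i _ => ?_
  have hcosh := Real.cosh_le_exp_half_sq (t * a i)
  rw [Real.cosh_eq] at hcosh
  have hpair : ∑ x : ℤˣ, Real.exp (t * (a i * ((x : ℤ) : ℝ))) =
      Real.exp (t * a i) + Real.exp (-(t * a i)) := by
    rw [show (univ : Finset ℤˣ) = {1, -1} from rfl, sum_pair (by decide)]
    simp
  rw [hpair, show t ^ 2 / 2 * a i ^ 2 = (t * a i) ^ 2 / 2 by ring]
  linarith

/-- Alternating signs, randomised on consecutive pairs, have partial sums in `[-1, 1]`. -/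
theorem abs_sum_range_alternating_le_one (s : ℕ → ℤˣ) (n : ℕ) :
    |∑ i ∈ range n, (((-1) ^ i * s (i / 2) : ℤˣ) : ℤ)| ≤ 1 := by
  have heven : ∀ m, ∑ i ∈ range (2 * m), (((-1) ^ i * s (i / 2) : ℤˣ) : ℤ) = 0 := by
    intro m
    induction m with
    | zero => simp
    | succ m ih =>
      rw [show 2 * (m + 1) = 2 * m + 1 + 1 by ring, sum_range_succ, sum_range_succ, ih,
        show (2 * m + 1) / 2 = m by omega, show 2 * m / 2 = m by omega]
      simp [pow_succ, pow_mul]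
  obtain ⟨m, rfl | rfl⟩ := n.even_or_odd'
  · rw [heven, abs_zero]
    exact zero_le_one
  · rw [sum_range_succ, heven, zero_add, Int.isUnit_iff_abs_eq.mp (Units.isUnit _)]

/-- The vertices can be grouped into pairs (and possibly one singleton) carrying opposite signs,
so that any choice of an orientation for each pair yields a balanced signing. -/
theorem exists_pairing (V : Type*) [Fintype V] :
    ∃ (p : V → Fin (Fintype.card V)) (c : V → ℤˣ),
      (∀ u v, p u = p v → u ≠ v → c u = -c v) ∧
      ∀ s : Fin (Fintype.card V) → ℤˣ, |∑ v, ((c v * s (p v) : ℤˣ) : ℤ)| ≤ 1 := by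
  let e := Fintype.equivFin V
  have hlt (v : V) : (e v : ℕ) / 2 < Fintype.card V := (Nat.div_le_self _ _).trans_lt (e v).2
  refine ⟨fun v => ⟨e v / 2, hlt v⟩, fun v => (-1) ^ (e v : ℕ), fun u v huv hne => ?_, fun s => ?_⟩
  · have hne' : (e u : ℕ) ≠ e v := fun h => hne (e.injective (Fin.ext h))
    simp only [Fin.mk.injEq] at huv
    have hsucc : (e u : ℕ) = e v + 1 ∨ (e v : ℕ) = e u + 1 := by omega
    rcases hsucc with h | h <;> simp [h, pow_succ]
  · let sExt : ℕ → ℤˣ := fun i => if h : i < Fintype.card V then s ⟨i, h⟩ else 1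
    have hsum : ∑ v, (((-1) ^ (e v : ℕ) * s ⟨e v / 2, hlt v⟩ : ℤˣ) : ℤ) =
        ∑ i ∈ range (Fintype.card V), (((-1) ^ i * sExt (i / 2) : ℤˣ) : ℤ) := by
      rw [← Fin.sum_univ_eq_sum_range (fun i => (((-1) ^ i * sExt (i / 2) : ℤˣ) : ℤ)),
        ← Equiv.sum_comp e]
      refine sum_congr rfl fun v _ => ?_
      simp only [sExt, dif_pos (hlt v)]
    rw [hsum]
    exact abs_sum_range_alternating_le_one sExt _

/-- The sum of signs over `N` is the number of positive signs minus the number of negative ones. -/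
theorem sum_units_eq_card_sub_card {V : Type*} (N : Finset V) (X : V → ℤˣ) :
    ∑ v ∈ N, (X v : ℤ) = (#{v ∈ N | X v = 1} : ℤ) - #{v ∈ N | ¬ X v = 1} := by
  rw [← sum_filter_add_sum_filter_not N (fun v => X v = 1), sub_eq_add_neg]
  congr 1
  · rw [sum_congr rfl (g := fun _ => (1 : ℤ)) fun v hv => by simp [(mem_filter.mp hv).2]]
    simp
  · rw [sum_congr rfl (g := fun _ => (-1 : ℤ)) fun v hv => by
      simp [(Int.units_eq_one_or (X v)).resolve_left (mem_filter.mp hv).2]]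
    simp

/-- Moment generating function bound for the discrepancy of a set `N` under a random signing
that is constant up to `c` on the fibers of a pairing `p`. -/
theorem sum_exp_pairing_le {V ι : Type*} [DecidableEq V] [Fintype ι] [DecidableEq ι]
    (p : V → ι) (c : V → ℤˣ) (hc : ∀ u v, p u = p v → u ≠ v → c u = -c v)
    (N : Finset V) (t : ℝ) :
    ∑ s : ι → ℤˣ, Real.exp (t * ∑ v ∈ N, (((c v * s (p v) : ℤˣ) : ℤ) : ℝ)) ≤
      2 ^ Fintype.card ι * Real.exp (t ^ 2 / 2 * #N) := by
  have hfiber (s : ι → ℤˣ) : ∑ v ∈ N, (((c v * s (p v) : ℤˣ) : ℤ) : ℝ) =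
      ∑ i, (∑ v ∈ N with p v = i, ((c v : ℤ) : ℝ)) * ((s i : ℤ) : ℝ) := by
    rw [← sum_fiberwise N p]
    refine sum_congr rfl fun i _ => ?_
    rw [sum_mul]
    refine sum_congr rfl fun v hv => ?_
    rw [(mem_filter.mp hv).2]
    push_cast
    rfl
  simp_rw [hfiber]
  refine (sum_exp_units_le _ t).trans ?_
  gcongr
  rw [card_eq_sum_card_fiberwise (f := p) (t := univ) fun _ _ => mem_univ _]
  push_cast
  refine sum_le_sum fun i _ => sq_sum_units_le_card _ c fun u hu v hv => hc u v ?_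
  rw [(mem_filter.mp hu).2, (mem_filter.mp hv).2]

/-- In tournaments of large minimum out-degree, the sum of `q ^ outDeg v` is small. -/
theorem exists_sum_pow_outDeg_lt {q : ℝ} (hq0 : 0 ≤ q) (hq1 : q < 1) {η : ℝ} (hη : 0 < η) :
    ∃ δ₀ : ℕ, ∀ (V : Type) [Fintype V] [DecidableEq V] (T : V → V → Prop) [DecidableRel T],
      IsTournament T → (∀ v, δ₀ ≤ outDeg T v) → ∑ v, q ^ outDeg T v < η := by
  have hsummable : Summable fun k : ℕ => (2 * (k : ℝ) + 1) * q ^ k := by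
    have h1 := summable_pow_mul_geometric_of_norm_lt_one 1
      (show ‖q‖ < 1 by rwa [Real.norm_of_nonneg hq0])
    have h0 := summable_geometric_of_lt_one hq0 hq1
    refine ((h1.mul_left 2).add h0).congr fun k => ?_
    ring
  obtain ⟨s, hs⟩ := summable_iff_vanishing_norm.mp hsummable η hη
  refine ⟨s.sup id + 1, fun V _ _ T _ hT hδ => ?_⟩
  have hdisj : Disjoint (univ.image (outDeg T)) s := by
    rw [disjoint_left]
    intro k hk hks
    obtain ⟨v, -, rfl⟩ := mem_image.mp hk
    have h1 := hδ v
    have h2 : outDeg T v ≤ s.sup id := le_sup (f := id) hks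
    omega
  refine lt_of_le_of_lt ?_ ((le_abs_self _).trans_lt (hs _ hdisj))
  rw [← sum_fiberwise_of_maps_to (fun v hv => mem_image_of_mem (outDeg T) hv)]
  refine sum_le_sum fun k _ => ?_
  rw [sum_congr rfl (g := fun _ => q ^ k) fun v hv => by rw [(mem_filter.mp hv).2], sum_const,
    nsmul_eq_mul]
  gcongr
  exact_mod_cast hT.card_outDeg_eq_le k

/-- For every `0 < ε < 1/2` there is `δ₀` such that every tournament with minimum
out-degree at least `δ₀` admits a bisection `(A, Aᶜ)` in which every vertex keeps at
least a `(1/2 - ε)` fraction of its out-neighbors in each part. -/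
theorem tournament_bisection (ε : ℝ) (hε0 : 0 < ε) (hε : ε < 1/2) :
    ∃ δ₀ : ℕ, ∀ (V : Type) [Fintype V] [DecidableEq V] (T : V → V → Prop) [DecidableRel T],
      IsTournament T →
      (∀ v, δ₀ ≤ outDeg T v) →
      ∃ A : Finset V,
        |(A.card : ℤ) - ((Aᶜ : Finset V).card : ℤ)| ≤ 1 ∧
        ∀ v, (1/2 - ε) * (outDeg T v : ℝ) ≤ (outDegIn T A v : ℝ) ∧
             (1/2 - ε) * (outDeg T v : ℝ) ≤ (outDegIn T Aᶜ v : ℝ) := by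
  have hq1 : Real.exp (-(2 * ε ^ 2)) < 1 := Real.exp_lt_one_iff.mpr (by nlinarith)
  obtain ⟨δ₀, hδ₀⟩ := exists_sum_pow_outDeg_lt (Real.exp_pos _).le hq1 (one_half_pos (α := ℝ))
  refine ⟨δ₀, fun V _ _ T _ hT hδ => ?_⟩
  have hsmall := hδ₀ V T hT hδ
  obtain ⟨p, c, hc, hbal⟩ := exists_pairing V
  let disc (s : Fin (Fintype.card V) → ℤˣ) (v : V) : ℝ :=
    ∑ w with T v w, (((c w * s (p w) : ℤˣ) : ℤ) : ℝ)
  have hmgf (t : ℝ) (ht : t ^ 2 = 4 * ε ^ 2) (v : V) :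
      ∑ s, Real.exp (t * disc s v - 4 * ε ^ 2 * outDeg T v) ≤
        2 ^ Fintype.card V * Real.exp (-(2 * ε ^ 2)) ^ outDeg T v := by
    have h := sum_exp_pairing_le p c hc {w | T v w} t
    rw [Fintype.card_fin, ht] at h
    simp_rw [sub_eq_add_neg, Real.exp_add, ← sum_mul]
    refine (mul_le_mul_of_nonneg_right h (Real.exp_pos _).le).trans_eq ?_
    rw [mul_assoc, ← Real.exp_add, ← Real.exp_nat_mul, outDeg]
    ring_nf
  obtain ⟨s, -, hs⟩ : ∃ s ∈ (univ : Finset (Fin (Fintype.card V) → ℤˣ)),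
      ∑ v, (Real.exp (2 * ε * disc s v - 4 * ε ^ 2 * outDeg T v) +
        Real.exp (-(2 * ε) * disc s v - 4 * ε ^ 2 * outDeg T v)) < 1 := by
    refine exists_lt_of_sum_lt ?_
    rw [sum_comm]
    calc _ ≤ ∑ v, 2 * 2 ^ Fintype.card V * Real.exp (-(2 * ε ^ 2)) ^ outDeg T v := by
          refine sum_le_sum fun v _ => ?_
          rw [sum_add_distrib]
          linarith [hmgf (2 * ε) (by ring) v, hmgf (-(2 * ε)) (by ring) v]
      _ < 2 * 2 ^ Fintype.card V * (1 / 2) := by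
          rw [← mul_sum]
          gcongr
      _ = 2 ^ Fintype.card V := by ring
      _ = _ := by simp
  have hdisc (v : V) : |disc s v| ≤ 2 * ε * outDeg T v := by
    have hv := (single_le_sum (fun v _ => by positivity) (mem_univ v)).trans_lt hs
    have h1 := Real.exp_lt_one_iff.mp ((lt_add_of_pos_right _ (Real.exp_pos _)).trans hv)
    have h2 := Real.exp_lt_one_iff.mp ((lt_add_of_pos_left _ (Real.exp_pos _)).trans hv)
    rw [abs_le]
    constructor <;> nlinarith
  refine ⟨({w | c w * s (p w) = 1} : Finset V), ?_, fun v => ?_⟩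
  · rw [compl_filter, ← sum_units_eq_card_sub_card]
    exact hbal s
  · have hdiff := sum_units_eq_card_sub_card {w | T v w} fun w => c w * s (p w)
    have hadd := card_filter_add_card_filter_not (s := {w | T v w})
      (fun w => c w * s (p w) = 1)
    have hA : outDegIn T ({w | c w * s (p w) = 1} : Finset V) v =
        #{w ∈ ({w | T v w} : Finset V) | c w * s (p w) = 1} := by
      rw [outDegIn, filter_comm]
    have hB : outDegIn T ({w | c w * s (p w) = 1} : Finset V)ᶜ v =
        #{w ∈ ({w | T v w} : Finset V) | ¬ c w * s (p w) = 1} := by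
      rw [outDegIn, compl_filter, filter_comm]
    rw [← hA, ← hB] at hdiff hadd
    have hdiff' : disc s v = (outDegIn T ({w | c w * s (p w) = 1} : Finset V) v : ℝ) -
        outDegIn T ({w | c w * s (p w) = 1} : Finset V)ᶜ v := by
      simp only [disc]
      exact_mod_cast hdiff
    have hadd' : (outDegIn T ({w | c w * s (p w) = 1} : Finset V) v : ℝ) +
        outDegIn T ({w | c w * s (p w) = 1} : Finset V)ᶜ v = outDeg T v := by
      exact_mod_cast hadd
    have := abs_le.mp (hdisc v)
    constructor <;> linarith
end

section
/- For every real ε with 0 < ε < 1/2, there exists an integer δ₀ such that every digraph D with minimum out-degree δ⁺(D) ≥ δ₀ and maximum in-degree Δ⁻(D) ≤ e^{ε²(δ⁺(D)−1)} / (8·δ⁺(D)) admits a bisection (A, B) of its vertex set such that for every vertex v of D, both d_A⁺(v) ≥ (1/2 − ε)·d_D⁺(v) and d_B⁺(v) ≥ (1/2 − ε)·d_D⁺(v). -/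
open Finset

/-- In-degree of `v` in the digraph `D`. -/
def inDeg {V : Type*} [Fintype V] (D : V → V → Prop) [DecidableRel D] (v : V) : ℕ :=
  (Finset.univ.filter (fun u => D u v)).card

/-- Minimum out-degree of the digraph `D`. -/
def minOutDeg {V : Type*} [Fintype V] [Nonempty V] (D : V → V → Prop)
    [DecidableRel D] : ℕ :=
  Finset.univ.inf' Finset.univ_nonempty (outDeg D)

open scoped Classical in
/-- The outcomes avoiding all the events `A j` with `j ∈ S`. -/
noncomputable def avoiding {Ω ι : Type*} [Fintype Ω] (A : ι → Finset Ω) (S : Finset ι) : Finset Ω :=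
  univ.filter (fun ω => ∀ j ∈ S, ω ∉ A j)

theorem mem_avoiding {Ω ι : Type*} [Fintype Ω] {A : ι → Finset Ω} {S : Finset ι} {ω : Ω} :
    ω ∈ avoiding A S ↔ ∀ j ∈ S, ω ∉ A j := by
  classical
  simp [avoiding]

theorem avoiding_anti {Ω ι : Type*} [Fintype Ω] (A : ι → Finset Ω) {S T : Finset ι} (h : S ⊆ T) :
    avoiding A T ⊆ avoiding A S := fun _ hω =>
  mem_avoiding.2 fun j hj => mem_avoiding.1 hω j (h hj)

theorem card_avoiding_insert_ge {Ω ι : Type*} [Fintype Ω] [DecidableEq Ω] [DecidableEq ι]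
    {A : ι → Finset Ω} {x : ℝ} {i : ι} {S : Finset ι}
    (h : (#(A i ∩ avoiding A S) : ℝ) ≤ x * #(avoiding A S)) :
    (1 - x) * #(avoiding A S) ≤ (#(avoiding A (insert i S)) : ℝ) := by
  have hsub : avoiding A S ⊆ (A i ∩ avoiding A S) ∪ avoiding A (insert i S) := by
    intro ω hω
    by_cases hi : ω ∈ A i
    · exact mem_union_left _ (mem_inter.2 ⟨hi, hω⟩)
    · refine mem_union_right _ (mem_avoiding.2 fun j hj => ?_)
      rcases mem_insert.1 hj with rfl | hj
      · exact hi
      · exact mem_avoiding.1 hω j hj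
  have hcard : (#(avoiding A S) : ℝ) ≤
      #(A i ∩ avoiding A S) + #(avoiding A (insert i S)) := by
    exact_mod_cast (card_le_card hsub).trans (card_union_le _ _)
  linarith

/-- Conditional form of the symmetric lopsided Lovász local lemma, for the uniform measure. -/
theorem card_inter_avoiding_le {Ω ι : Type*} [Fintype Ω] [DecidableEq Ω] [DecidableEq ι]
    {A : ι → Finset Ω} {Γ : ι → Finset ι} {x : ℝ} (hx0 : 0 ≤ x) (hx1 : x ≤ 1)
    (h : ∀ i S, Disjoint S (Γ i) →
      (#(A i ∩ avoiding A S) : ℝ) ≤ x * (1 - x) ^ #(Γ i) * #(avoiding A S))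
    (S : Finset ι) (i : ι) :
    (#(A i ∩ avoiding A S) : ℝ) ≤ x * #(avoiding A S) := by
  induction S using Finset.strongInduction generalizing i with
  | H S ih =>
    have hpos : 0 ≤ 1 - x := sub_nonneg.2 hx1
    have key : ∀ R ⊆ S ∩ Γ i,
        (1 - x) ^ #R * #(avoiding A (S \ Γ i)) ≤ (#(avoiding A (R ∪ S \ Γ i)) : ℝ) := by
      intro R
      induction R using Finset.induction_on with
      | empty => simp
      | insert a R ha ihR =>
        intro hR
        have haS : a ∈ S ∩ Γ i := hR (mem_insert_self a R)
        have hRS : R ⊆ S ∩ Γ i := (subset_insert a R).trans hR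
        have hss : R ∪ S \ Γ i ⊂ S := by
          refine (ssubset_iff_of_subset (union_subset (hRS.trans inter_subset_left)
            sdiff_subset)).2 ⟨a, (mem_inter.1 haS).1, ?_⟩
          simp [ha, (mem_inter.1 haS).2]
        rw [card_insert_of_notMem ha, insert_union, pow_succ', mul_assoc]
        exact (mul_le_mul_of_nonneg_left (ihR hRS) hpos).trans
          (card_avoiding_insert_ge (ih _ hss a))
    have hS : S ∩ Γ i ∪ S \ Γ i = S := by
      ext j
      simp only [mem_union, mem_inter, mem_sdiff]
      tauto
    have hkey := key _ subset_rfl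
    rw [hS] at hkey
    calc (#(A i ∩ avoiding A S) : ℝ) ≤ #(A i ∩ avoiding A (S \ Γ i)) := by
          exact_mod_cast card_le_card
            (inter_subset_inter_left (avoiding_anti A sdiff_subset))
      _ ≤ x * (1 - x) ^ #(Γ i) * #(avoiding A (S \ Γ i)) := h i _ sdiff_disjoint
      _ ≤ x * (1 - x) ^ #(S ∩ Γ i) * #(avoiding A (S \ Γ i)) := by
          gcongr ?_ * ?_ * _
          exact pow_le_pow_of_le_one hpos (by linarith) (card_le_card inter_subset_right)
      _ ≤ x * #(avoiding A S) := by
          rw [mul_assoc]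
          exact mul_le_mul_of_nonneg_left hkey hx0

/-- The symmetric lopsided Lovász local lemma, for the uniform measure on a finite type. -/
theorem exists_forall_notMem_of_lopsided {Ω ι : Type*} [Fintype Ω] [Nonempty Ω] [DecidableEq Ω]
    [Fintype ι] [DecidableEq ι]
    {A : ι → Finset Ω} {Γ : ι → Finset ι} {x : ℝ} (hx0 : 0 ≤ x) (hx1 : x < 1)
    (h : ∀ i S, Disjoint S (Γ i) →
      (#(A i ∩ avoiding A S) : ℝ) ≤ x * (1 - x) ^ #(Γ i) * #(avoiding A S)) :
    ∃ ω, ∀ i, ω ∉ A i := by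
  have hpos : ∀ S : Finset ι, 0 < (#(avoiding A S) : ℝ) := by
    intro S
    induction S using Finset.induction_on with
    | empty =>
      obtain ⟨ω⟩ := ‹Nonempty Ω›
      exact_mod_cast card_pos.2 ⟨ω, mem_avoiding.2 (by simp)⟩
    | insert a S _ ih =>
      exact (mul_pos (sub_pos.2 hx1) ih).trans_le
        (card_avoiding_insert_ge (card_inter_avoiding_le hx0 hx1.le h S a))
  obtain ⟨ω, hω⟩ := card_pos.1 (Nat.cast_pos.1 (hpos univ))
  exact ⟨ω, fun i => mem_avoiding.1 hω i (mem_univ i)⟩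

/-- Sets of functions determined by complementary sets of coordinates are independent. -/
theorem card_inter_mul_card_le {P β : Type*} [Fintype P] [DecidableEq P] [Fintype β]
    [DecidableEq β] (T : Finset P) (A B : Finset (P → β))
    (hA : ∀ ω ω' : P → β, (∀ p ∈ T, ω p = ω' p) → ω ∈ A → ω' ∈ A)
    (hB : ∀ ω ω' : P → β, (∀ p ∉ T, ω p = ω' p) → ω ∈ B → ω' ∈ B) :
    #(A ∩ B) * Fintype.card (P → β) ≤ #A * #B := by
  rw [← card_univ, ← card_product, ← card_product]
  refine card_le_card_of_injOn (fun q => (T.piecewise q.1 q.2, T.piecewise q.2 q.1)) ?_ ?_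
  · rintro ⟨ω, ω'⟩ hq
    simp only [coe_product, Set.mem_prod, mem_coe, mem_inter, mem_univ, and_true] at hq ⊢
    exact ⟨hA ω _ (fun p hp => by simp [hp]) hq.1, hB ω _ (fun p hp => by simp [hp]) hq.2⟩
  · rintro ⟨a, b⟩ - ⟨c, d⟩ - hq
    simp only [Prod.mk.injEq] at hq ⊢
    constructor <;> funext p
    · by_cases hp : p ∈ T
      · simpa [hp] using congrFun hq.1 p
      · simpa [hp] using congrFun hq.2 p
    · by_cases hp : p ∈ T
      · simpa [hp] using congrFun hq.2 p
      · simpa [hp] using congrFun hq.1 p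

/-- The sign `1` or `-1` of a Boolean. -/
def boolSign (b : Bool) : ℤ := if b then 1 else -1

theorem sum_exp_signed_le {P : Type*} [Fintype P] [DecidableEq P] (a : P → ℝ) :
    ∑ ω : P → Bool, Real.exp (∑ p, a p * boolSign (ω p)) ≤
      Fintype.card (P → Bool) * Real.exp ((∑ p, a p ^ 2) / 2) := by
  have h1 : ∑ ω : P → Bool, Real.exp (∑ p, a p * boolSign (ω p)) =
      ∏ p, ∑ b : Bool, Real.exp (a p * boolSign b) := by
    rw [Finset.prod_univ_sum, Fintype.piFinset_univ]
    simp_rw [Real.exp_sum]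
  have h2 : (Fintype.card (P → Bool) : ℝ) * Real.exp ((∑ p, a p ^ 2) / 2) =
      ∏ p, 2 * Real.exp (a p ^ 2 / 2) := by
    rw [prod_mul_distrib, ← Real.exp_sum, sum_div]
    simp
  rw [h1, h2]
  refine prod_le_prod (fun p _ => sum_nonneg fun b _ => (Real.exp_pos _).le) fun p _ => ?_
  have := Real.cosh_le_exp_half_sq (a p)
  rw [Real.cosh_eq] at this
  simp only [Fintype.sum_bool, boolSign]
  norm_num
  linarith

/-- Hoeffding's one-sided bound for a signed sum, in counting form. -/
theorem card_signed_sum_gt_le {P : Type*} [Fintype P] [DecidableEq P] (a : P → ℝ) {k ε : ℝ}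
    (ha : ∑ p, a p ^ 2 ≤ k) (hε : 0 ≤ ε) :
    (#{ω : P → Bool | 2 * ε * k < ∑ p, a p * boolSign (ω p)} : ℝ) ≤
      Fintype.card (P → Bool) * Real.exp (-(2 * ε ^ 2 * k)) := by
  set F : Finset (P → Bool) := {ω : P → Bool | 2 * ε * k < ∑ p, a p * boolSign (ω p)} with hF
  have hle : (#F : ℝ) * Real.exp (4 * ε ^ 2 * k) ≤
      Fintype.card (P → Bool) * Real.exp (2 * ε ^ 2 * k) := by
    calc (#F : ℝ) * Real.exp (4 * ε ^ 2 * k)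
        = ∑ ω ∈ F, Real.exp (4 * ε ^ 2 * k) := by simp
      _ ≤ ∑ ω ∈ F, Real.exp (∑ p, (2 * ε * a p) * boolSign (ω p)) := by
          refine sum_le_sum fun ω hω => Real.exp_le_exp.2 ?_
          have hω' := (mem_filter.1 hω).2
          simp_rw [mul_assoc (2 * ε), ← mul_sum]
          nlinarith
      _ ≤ ∑ ω : P → Bool, Real.exp (∑ p, (2 * ε * a p) * boolSign (ω p)) :=
          sum_le_sum_of_subset_of_nonneg (subset_univ _) fun _ _ _ => (Real.exp_pos _).le
      _ ≤ Fintype.card (P → Bool) * Real.exp ((∑ p, (2 * ε * a p) ^ 2) / 2) :=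
          sum_exp_signed_le _
      _ ≤ Fintype.card (P → Bool) * Real.exp (2 * ε ^ 2 * k) := by
          gcongr
          simp_rw [mul_pow, ← mul_sum]
          nlinarith [mul_le_mul_of_nonneg_left ha (sq_nonneg ε)]
  have hexp : Real.exp (2 * ε ^ 2 * k) =
      Real.exp (-(2 * ε ^ 2 * k)) * Real.exp (4 * ε ^ 2 * k) := by
    rw [← Real.exp_add]
    ring_nf
  rw [hexp, ← mul_assoc] at hle
  exact le_of_mul_le_mul_right hle (Real.exp_pos _)

/-- The two-sided version of `card_signed_sum_gt_le`. -/
theorem card_abs_signed_sum_gt_le {P : Type*} [Fintype P] [DecidableEq P] (a : P → ℝ) {k ε : ℝ}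
    (ha : ∑ p, a p ^ 2 ≤ k) (hε : 0 ≤ ε) :
    (#{ω : P → Bool | 2 * ε * k < |∑ p, a p * boolSign (ω p)|} : ℝ) ≤
      2 * Real.exp (-(2 * ε ^ 2 * k)) * Fintype.card (P → Bool) := by
  have hpos := card_signed_sum_gt_le a ha hε
  have hneg := card_signed_sum_gt_le (fun p => -a p) (by simpa using ha) hε
  have hsub : ({ω : P → Bool | 2 * ε * k < |∑ p, a p * boolSign (ω p)|} : Finset _) ⊆
      univ.filter (fun ω : P → Bool => 2 * ε * k < ∑ p, a p * boolSign (ω p)) ∪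
      univ.filter (fun ω : P → Bool => 2 * ε * k < ∑ p, -a p * boolSign (ω p)) := by
    intro ω
    simp only [mem_union, mem_filter, mem_univ, true_and, neg_mul, sum_neg_distrib]
    exact lt_abs.1
  have hcard := (card_le_card hsub).trans (card_union_le _ _)
  have hcard' := (Nat.cast_le (α := ℝ)).2 hcard
  push_cast at hcard'
  linarith

/-- The signed number of elements of `N` in the fibre of `π` over `p`. -/
def fibreSign {V P : Type*} [DecidableEq P] (π : V → P) (s : V → Bool) (N : Finset V) (p : P) : ℤ :=
  ∑ w ∈ N with π w = p, boolSign (s w)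

theorem sum_fibreSign_mul {V P : Type*} [Fintype P] [DecidableEq P] (π : V → P) (s : V → Bool)
    (N : Finset V) (ω : P → Bool) :
    ∑ p, fibreSign π s N p * boolSign (ω p) = ∑ w ∈ N, boolSign (s w) * boolSign (ω (π w)) := by
  rw [← sum_fiberwise N π]
  refine sum_congr rfl fun p _ => ?_
  rw [fibreSign, sum_mul]
  refine sum_congr rfl fun w hw => ?_
  rw [(mem_filter.1 hw).2]

theorem card_sub_card_eq_sum {V P : Type*} (π : V → P) (s : V → Bool)
    (N : Finset V) (ω : P → Bool) :
    (#{w ∈ N | ω (π w) = s w} : ℤ) - #{w ∈ N | ¬ ω (π w) = s w} =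
      ∑ w ∈ N, boolSign (s w) * boolSign (ω (π w)) := by
  rw [card_filter, card_filter]
  push_cast
  rw [← sum_sub_distrib]
  refine sum_congr rfl fun w _ => ?_
  cases ω (π w) <;> cases s w <;> simp [boolSign]

theorem sum_fibreSign_sq_le {V P : Type*} [Fintype P] [DecidableEq P] {π : V → P} {s : V → Bool}
    (h : Function.Injective fun v => (π v, s v)) (N : Finset V) :
    ∑ p, fibreSign π s N p ^ 2 ≤ #N := by
  have hN : (#N : ℤ) = ∑ p, (#{w ∈ N | π w = p} : ℤ) := by
    exact_mod_cast card_eq_sum_card_fiberwise (f := π) (t := univ) (by simp)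
  rw [hN]
  refine sum_le_sum fun p _ => ?_
  have hb : ∀ b : Bool, #{w ∈ {w ∈ N | π w = p} | s w = b} ≤ 1 := by
    intro b
    refine card_le_one.2 fun v hv w hw => h ?_
    simp only [mem_filter] at hv hw
    simp [hv, hw]
  have hcard : #{w ∈ N | π w = p} =
      #{w ∈ {w ∈ N | π w = p} | s w = true} + #{w ∈ {w ∈ N | π w = p} | s w = false} := by
    rw [card_eq_sum_card_fiberwise (f := s) (t := univ) fun _ _ => mem_coe.2 (mem_univ _)]
    simp
  have hsign : fibreSign π s N p = (#{w ∈ {w ∈ N | π w = p} | s w = true} : ℤ) -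
      #{w ∈ {w ∈ N | π w = p} | s w = false} := by
    rw [fibreSign, ← sum_fiberwise _ s, Fintype.sum_bool, sub_eq_add_neg]
    congr 1
    · rw [sum_congr rfl fun w hw => by rw [(mem_filter.1 hw).2]]
      simp [boolSign]
    · rw [sum_congr rfl fun w hw => by rw [(mem_filter.1 hw).2]]
      simp [boolSign]
  have ht := hb true
  have hf := hb false
  rw [hsign, hcard]
  generalize #{w ∈ {w ∈ N | π w = p} | s w = true} = c at *
  generalize #{w ∈ {w ∈ N | π w = p} | s w = false} = d at *
  interval_cases c <;> interval_cases d <;> norm_num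

theorem sum_range_alternating_pairs (f : ℕ → ℤ) (m : ℕ) :
    ∑ i ∈ range (2 * m), boolSign (decide (i % 2 = 0)) * f (i / 2) = 0 := by
  induction m with
  | zero => simp
  | succ m ih =>
    rw [Nat.mul_succ, sum_range_succ, sum_range_succ, ih]
    have h1 : (2 * m + 1) / 2 = m := by omega
    have h2 : (2 * m + 1) % 2 = 1 := by omega
    simp [h1, h2, boolSign]

theorem abs_sum_range_alternating_le {f : ℕ → ℤ} (hf : ∀ j, |f j| ≤ 1) (n : ℕ) :
    |∑ i ∈ range n, boolSign (decide (i % 2 = 0)) * f (i / 2)| ≤ 1 := by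
  rcases Nat.even_or_odd' n with ⟨m, rfl | rfl⟩
  · simp [sum_range_alternating_pairs]
  · rw [sum_range_succ, sum_range_alternating_pairs]
    simpa [boolSign] using hf m

/-- The elements of a finite type can be grouped into pairs of opposite sign, leaving at most one
element without a partner. -/
theorem exists_signed_pairing (V : Type*) [Fintype V] :
    ∃ (π : V → Fin (Fintype.card V)) (s : V → Bool),
      (Function.Injective fun v => (π v, s v)) ∧
      ∀ ω : Fin (Fintype.card V) → Bool, |∑ v, boolSign (s v) * boolSign (ω (π v))| ≤ 1 := by
  set n := Fintype.card V with hn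
  let e : V ≃ Fin n := Fintype.equivFin V
  refine ⟨fun v => ⟨e v / 2, (Nat.div_le_self _ _).trans_lt (e v).2⟩,
    fun v => decide ((e v : ℕ) % 2 = 0), fun v w hvw => ?_, fun ω => ?_⟩
  · simp only [Prod.mk.injEq, Fin.mk.injEq, decide_eq_decide] at hvw
    apply e.injective
    ext
    omega
  · let f : ℕ → ℤ := fun j => if h : j < n then boolSign (ω ⟨j, h⟩) else 0
    have hf : ∀ j, |f j| ≤ 1 := by
      intro j
      by_cases h : j < n
      · cases hω : ω ⟨j, h⟩ <;> simp [f, h, hω, boolSign]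
      · simp [f, h]
    have key := abs_sum_range_alternating_le hf n
    rw [← Fin.sum_univ_eq_sum_range (fun i => boolSign (decide (i % 2 = 0)) * f (i / 2)) n,
      ← e.sum_comp] at key
    convert key using 4 with v
    have hv : (e v : ℕ) / 2 < n := (Nat.div_le_self _ _).trans_lt (e v).2
    simp [f, hv]

/-- If every out-degree is large compared with the logarithm of a bound `E` on the in-degrees, then
the vertices, grouped into signed pairs, have a choice of orientations of the pairs that is nearly
balanced on all out-neighbourhoods. -/
theorem exists_balanced_orientation {V P : Type*} [Fintype V] [DecidableEq V] [Fintype P]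
    [DecidableEq P] (D : V → V → Prop) [DecidableRel D] {π : V → P} {s : V → Bool}
    (hinj : Function.Injective fun v => (π v, s v)) {ε x E : ℝ} (hε : 0 ≤ ε)
    (hx0 : 0 ≤ x) (hx1 : x < 1) (hE : ∀ v, (inDeg D v : ℝ) ≤ E)
    (hprob : ∀ v, ∀ m : ℕ, (m : ℝ) ≤ 2 * outDeg D v * E →
      2 * Real.exp (-(2 * ε ^ 2 * outDeg D v)) ≤ x * (1 - x) ^ m) :
    ∃ ω : P → Bool, ∀ v, |((∑ p, fibreSign π s {w | D v w} p * boolSign (ω p) : ℤ) : ℝ)| ≤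
      2 * ε * outDeg D v := by
  classical
  let N : V → Finset V := fun v => {w | D v w}
  let A : V → Finset (P → Bool) := fun v =>
    {ω | 2 * ε * outDeg D v < |∑ p, (fibreSign π s (N v) p : ℝ) * boolSign (ω p)|}
  let Γ : V → Finset V := fun v =>
    (N v).biUnion fun w => ({w' | π w' = π w} : Finset V).biUnion fun w' => {u | D u w'}
  have hA : ∀ v, ∀ ω ω' : P → Bool, (∀ w ∈ N v, ω (π w) = ω' (π w)) → ω ∈ A v → ω' ∈ A v := by
    intro v ω ω' h hω
    simp only [A, mem_filter, mem_univ, true_and] at hω ⊢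
    have heq : ∑ p, fibreSign π s (N v) p * boolSign (ω p) =
        ∑ p, fibreSign π s (N v) p * boolSign (ω' p) := by
      rw [sum_fibreSign_mul, sum_fibreSign_mul]
      exact sum_congr rfl fun w hw => by rw [h w hw]
    have heq' := congrArg (Int.cast : ℤ → ℝ) heq
    push_cast at heq'
    rwa [← heq']
  have hΓ : ∀ v, (#(Γ v) : ℝ) ≤ 2 * outDeg D v * E := by
    intro v
    have hfib : ∀ w, #({w' | π w' = π w} : Finset V) ≤ 2 := by
      intro w
      rw [← Fintype.card_bool, ← card_univ]
      refine card_le_card_of_injOn s (fun _ _ => mem_coe.2 (mem_univ _)) fun a ha b hb hab => hinj ?_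
      simp only [coe_filter, mem_univ, true_and, Set.mem_ofPred_eq] at ha hb
      simp [ha, hb, hab]
    have hE0 : 0 ≤ E := (Nat.cast_nonneg _).trans (hE v)
    have hin : ∀ w, (#(({w' | π w' = π w} : Finset V).biUnion fun w' => {u | D u w'}) : ℝ) ≤
        2 * E := by
      intro w
      calc (#(({w' | π w' = π w} : Finset V).biUnion fun w' => {u | D u w'}) : ℝ)
          ≤ ∑ w' ∈ ({w' | π w' = π w} : Finset V), (inDeg D w' : ℝ) := by
            exact_mod_cast card_biUnion_le
        _ ≤ #({w' | π w' = π w} : Finset V) • E := sum_le_card_nsmul _ _ _ fun w' _ => hE w'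
        _ ≤ 2 * E := by
            rw [nsmul_eq_mul]
            gcongr
            exact_mod_cast hfib w
    calc (#(Γ v) : ℝ) ≤ ∑ w ∈ N v,
          (#(({w' | π w' = π w} : Finset V).biUnion fun w' => {u | D u w'}) : ℝ) := by
          exact_mod_cast card_biUnion_le
      _ ≤ #(N v) • (2 * E) := sum_le_card_nsmul _ _ _ fun w _ => hin w
      _ = 2 * outDeg D v * E := by
          rw [nsmul_eq_mul, show #(N v) = outDeg D v from rfl]
          ring
  obtain ⟨ω, hω⟩ := exists_forall_notMem_of_lopsided (A := A) (Γ := Γ) hx0 hx1 (by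
    intro v S hS
    have hB : ∀ ω ω' : P → Bool, (∀ p ∉ (N v).image π, ω p = ω' p) →
        ω ∈ avoiding A S → ω' ∈ avoiding A S := by
      intro ω ω' h hω
      refine mem_avoiding.2 fun u hu hu' => mem_avoiding.1 hω u hu ?_
      refine hA u ω' ω (fun w' hw' => (h _ fun hmem => ?_).symm) hu'
      obtain ⟨w, hw, hww⟩ := mem_image.1 hmem
      refine disjoint_left.1 hS hu (mem_biUnion.2 ⟨w, hw, mem_biUnion.2 ⟨w', ?_, ?_⟩⟩)
      · simp [hww]
      · simpa [N] using hw'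
    have hind := card_inter_mul_card_le ((N v).image π) (A v) (avoiding A S)
      (fun ω ω' h => hA v ω ω' fun w hw => h _ (mem_image_of_mem π hw)) hB
    have hind' : (#(A v ∩ avoiding A S) : ℝ) * Fintype.card (P → Bool) ≤
        #(A v) * #(avoiding A S) := by exact_mod_cast hind
    have hhoeff : (#(A v) : ℝ) ≤
        2 * Real.exp (-(2 * ε ^ 2 * outDeg D v)) * Fintype.card (P → Bool) :=
      card_abs_signed_sum_gt_le (fun p => (fibreSign π s (N v) p : ℝ))
        (by exact_mod_cast sum_fibreSign_sq_le hinj (N v)) hε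
    have hcard : (0 : ℝ) < Fintype.card (P → Bool) := by exact_mod_cast Fintype.card_pos
    refine le_of_mul_le_mul_right (hind'.trans ?_) hcard
    calc (#(A v) : ℝ) * #(avoiding A S)
        ≤ (x * (1 - x) ^ #(Γ v) * Fintype.card (P → Bool)) * #(avoiding A S) := by
          gcongr
          exact hhoeff.trans (mul_le_mul_of_nonneg_right (hprob v _ (hΓ v)) hcard.le)
      _ = x * (1 - x) ^ #(Γ v) * #(avoiding A S) * Fintype.card (P → Bool) := by ring)
  refine ⟨ω, fun v => ?_⟩
  have hv := hω v
  simp only [A, mem_filter, mem_univ, true_and, not_lt] at hv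
  exact_mod_cast hv

theorem exp_neg_two_mul_le_one_sub {x : ℝ} (hx0 : 0 ≤ x) (hx : x ≤ 1 / 2) :
    Real.exp (-(2 * x)) ≤ 1 - x := by
  have h1 : 1 + 2 * x ≤ Real.exp (2 * x) := by linarith [Real.add_one_le_exp (2 * x)]
  rw [Real.exp_neg]
  refine (inv_anti₀ (by linarith) h1).trans ?_
  rw [inv_le_iff_one_le_mul₀ (by linarith)]
  nlinarith

/-- The numerical condition making the local lemma applicable. -/
theorem two_mul_exp_le_weight {c d k E x : ℝ} {m : ℕ} (hc0 : 0 < c) (hd : 2 ≤ c * d) (hdk : d ≤ k)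
    (hE0 : 1 ≤ E) (hc : c ≤ 1) (hE : E = Real.exp (c * (d - 1)) / (8 * d)) (hx : x = c / (8 * E))
    (hm : (m : ℝ) ≤ 2 * k * E) :
    2 * Real.exp (-(2 * c * k)) ≤ x * (1 - x) ^ m := by
  have hd0 : 0 < d := by nlinarith
  have hx0 : 0 < x := by rw [hx]; positivity
  have hx1 : x ≤ 1 / 2 := by
    rw [hx, div_le_iff₀ (by positivity)]
    linarith
  have hpow : Real.exp (-(c * k / 2)) ≤ (1 - x) ^ m := by
    refine le_trans ?_ (pow_le_pow_left₀ (Real.exp_pos _).le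
      (exp_neg_two_mul_le_one_sub hx0.le hx1) m)
    rw [← Real.exp_nat_mul]
    refine Real.exp_le_exp.2 ?_
    have hxE : x * E = c / 8 := by
      rw [hx]
      field_simp
    nlinarith [mul_le_mul_of_nonneg_left hm hx0.le]
  have hx2 : 2 * Real.exp (-(c * k)) ≤ x := by
    have hxd : x = c * d * Real.exp (-(c * (d - 1))) := by
      rw [hx, hE, Real.exp_neg]
      field_simp
    rw [hxd]
    gcongr
    nlinarith
  calc 2 * Real.exp (-(2 * c * k)) ≤ 2 * Real.exp (-(c * k)) * Real.exp (-(c * k / 2)) := by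
        rw [mul_assoc 2 (Real.exp _), ← Real.exp_add]
        gcongr
        nlinarith
    _ ≤ x * (1 - x) ^ m := by gcongr

/-- For every `0 < ε < 1/2` there is `δ₀` such that every (simple, loopless) digraph `D`
with minimum out-degree `δ⁺(D) ≥ δ₀` and maximum in-degree at most
`exp(ε² (δ⁺(D) - 1)) / (8 δ⁺(D))` admits a bisection `(A, Aᶜ)` in which every vertex
keeps at least a `(1/2 - ε)` fraction of its out-neighbors in each part. -/
theorem digraph_bisection_of_bounded_in_degree (ε : ℝ) (hε0 : 0 < ε) (hε : ε < 1/2) :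
    ∃ δ₀ : ℕ, ∀ (V : Type) [Fintype V] [Nonempty V] [DecidableEq V]
      (D : V → V → Prop) [DecidableRel D],
      (∀ v, ¬ D v v) →
      δ₀ ≤ minOutDeg D →
      (∀ v, (inDeg D v : ℝ) ≤
        Real.exp (ε ^ 2 * ((minOutDeg D : ℝ) - 1)) / (8 * (minOutDeg D : ℝ))) →
      ∃ A : Finset V,
        |(A.card : ℤ) - ((Aᶜ : Finset V).card : ℤ)| ≤ 1 ∧
        ∀ v, (1/2 - ε) * (outDeg D v : ℝ) ≤ (outDegIn D A v : ℝ) ∧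
             (1/2 - ε) * (outDeg D v : ℝ) ≤ (outDegIn D Aᶜ v : ℝ) := by
  refine ⟨⌈2 / ε ^ 2⌉₊, fun V _ _ _ D _ _ hδ hin => ?_⟩
  set d : ℝ := (minOutDeg D : ℝ) with hd
  set E : ℝ := Real.exp (ε ^ 2 * (d - 1)) / (8 * d) with hE
  have hc0 : 0 < ε ^ 2 := by positivity
  have hc1 : ε ^ 2 ≤ 1 := by nlinarith
  have hcd : 2 ≤ ε ^ 2 * d := by
    have h : 2 / ε ^ 2 ≤ d := (Nat.le_ceil _).trans (Nat.cast_le.2 hδ)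
    rw [div_le_iff₀ hc0] at h
    linarith
  have hmin : ∀ v, d ≤ (outDeg D v : ℝ) := fun v =>
    Nat.cast_le.2 (inf'_le (outDeg D) (mem_univ v))
  have hE1 : 1 ≤ E := by
    obtain ⟨v⟩ := ‹Nonempty V›
    have hpos : (0 : ℝ) < outDeg D v := by nlinarith [hmin v]
    obtain ⟨w, hw⟩ := card_pos.1 (Nat.cast_pos.1 hpos)
    have hw' : 0 < inDeg D w := card_pos.2 ⟨v, by simpa using hw⟩
    exact le_trans (by exact_mod_cast hw') (hin w)
  obtain ⟨π, s, hinj, hbal⟩ := exists_signed_pairing V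
  have hx1 : ε ^ 2 / (8 * E) < 1 := by
    rw [div_lt_one (by positivity)]
    linarith
  obtain ⟨ω, hω⟩ := exists_balanced_orientation D hinj hε0.le (x := ε ^ 2 / (8 * E)) (by positivity)
    hx1 hin fun v m hm => two_mul_exp_le_weight hc0 hcd (hmin v) hE1 hc1 hE rfl hm
  refine ⟨({v | ω (π v) = s v} : Finset V), ?_, fun v => ?_⟩
  · rw [compl_filter, card_sub_card_eq_sum]
    exact hbal ω
  · have hv := hω v
    rw [sum_fibreSign_mul, ← card_sub_card_eq_sum] at hv
    have hA : outDegIn D ({v | ω (π v) = s v} : Finset V) v =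
        #{w ∈ ({w | D v w} : Finset V) | ω (π w) = s w} := by
      rw [outDegIn, filter_comm]
    have hB : outDegIn D ({v | ω (π v) = s v} : Finset V)ᶜ v =
        #{w ∈ ({w | D v w} : Finset V) | ¬ ω (π w) = s w} := by
      rw [outDegIn, compl_filter, filter_comm]
    have hsum : outDegIn D ({v | ω (π v) = s v} : Finset V) v +
        outDegIn D ({v | ω (π v) = s v} : Finset V)ᶜ v = outDeg D v := by
      rw [hA, hB, card_filter_add_card_filter_not]
      rfl
    rw [← hA, ← hB] at hv
    have hsum' := congrArg (Nat.cast : ℕ → ℝ) hsum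
    push_cast at hsum' hv
    rw [abs_le] at hv
    constructor <;> linarith [hv.1, hv.2]
end

section
/- For every positive integer s, every s-minimal bipartite tournament D satisfies |V(D)| ≤ (s+1)⁴/(4s). -/
open Finset

/-- `D` is a `k`-partite tournament with parts given by the fibers of `part`. -/
def IsMultipartiteTournament {V : Type*} (k : ℕ) (D : V → V → Prop)
    (part : V → Fin k) : Prop :=
  Function.Surjective part ∧
  (∀ u v, D u v → part u ≠ part v) ∧
  (∀ u v, part u ≠ part v → (D u v ↔ ¬ D v u))

/-- `D` is `s`-minimal: its minimum out-degree is `s`, and every proper subdigraph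
(a nonempty vertex set `S` with an arc relation `E` contained in the restriction of
`D` to `S`, other than `D` itself) has minimum out-degree at most `s - 1`. -/
def IsSMinimal {V : Type*} [Fintype V] (D : V → V → Prop) [DecidableRel D]
    (s : ℕ) : Prop :=
  (∀ v, s ≤ outDeg D v) ∧ (∃ v, outDeg D v = s) ∧
  ∀ (S : Finset V) (E : V → V → Prop) [DecidableRel E],
    (∀ u v, E u v → u ∈ S ∧ v ∈ S ∧ D u v) →
    ¬ (S = Finset.univ ∧ ∀ u v, E u v ↔ D u v) →
    S.Nonempty →
    ∃ v ∈ S, outDeg E v < s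

/-- In an `s`-minimal digraph every vertex has out-degree exactly `s`. -/
theorem IsSMinimal.outDeg_eq {V : Type*} [Fintype V] {D : V → V → Prop} [DecidableRel D]
    {s : ℕ} (h : IsSMinimal D s) (v : V) : outDeg D v = s := by
  classical
  obtain ⟨hge, -, hsub⟩ := h
  by_contra hne
  have hlt : s < outDeg D v := lt_of_le_of_ne (hge v) (Ne.symm hne)
  obtain ⟨w, hw⟩ := Finset.card_pos.mp (Nat.zero_lt_of_lt hlt)
  have hvw : D v w := by simpa using hw
  obtain ⟨u, -, hu⟩ := hsub Finset.univ (fun x y => D x y ∧ ¬ (x = v ∧ y = w))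
    (fun x y hxy => ⟨Finset.mem_univ _, Finset.mem_univ _, hxy.1⟩)
    (fun hall => ((hall.2 v w).mpr hvw).2 ⟨rfl, rfl⟩) ⟨v, Finset.mem_univ v⟩
  by_cases huv : u = v
  · subst huv
    have herase : (Finset.univ.filter fun y => D u y ∧ ¬ (u = u ∧ y = w)) =
        (Finset.univ.filter fun y => D u y).erase w := by
      ext y
      simp [and_comm]
    have hcard := Finset.card_erase_of_mem hw
    rw [← herase] at hcard
    have hu' : (Finset.univ.filter fun y => D u y ∧ ¬ (u = u ∧ y = w)).card < s := by
      unfold outDeg at hu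
      convert hu
    unfold outDeg at hlt
    omega
  · have hge' := hge u
    simp only [outDeg, huv, false_and, not_false_eq_true, and_true] at hu hge'
    omega

/-- The out-degrees of a bipartite tournament add up to the product of the part sizes. -/
theorem IsMultipartiteTournament.sum_outDeg {V : Type*} [Fintype V] {D : V → V → Prop}
    [DecidableRel D] {part : V → Fin 2} (hD : IsMultipartiteTournament 2 D part) :
    ∑ v, outDeg D v =
      (Finset.univ.filter fun v => part v = 0).card *
        (Finset.univ.filter fun v => ¬ part v = 0).card := by
  classical
  obtain ⟨-, hne, hiff⟩ := hD
  have hpart : ∀ u v, part u ≠ part v ↔ (part u = 0 ↔ ¬ part v = 0) := by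
    intro u v
    omega
  rw [← Finset.sum_filter_add_sum_filter_not Finset.univ (fun v => part v = 0)]
  have hleft : ∑ u ∈ Finset.univ.filter (fun u => part u = 0), outDeg D u =
      ∑ v ∈ Finset.univ.filter (fun v => ¬ part v = 0),
        ((Finset.univ.filter fun u => part u = 0).filter fun u => D u v).card := by
    refine Eq.trans (Finset.sum_congr rfl fun u hu => ?_)
      (Finset.sum_card_bipartiteAbove_eq_sum_card_bipartiteBelow D)
    unfold outDeg Finset.bipartiteAbove
    congr 1
    ext w
    have h₁ := hne u w
    have h₂ := hpart u w
    simp only [Finset.mem_filter, Finset.mem_univ, true_and] at hu ⊢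
    tauto
  rw [hleft, ← Finset.sum_add_distrib, mul_comm, ← smul_eq_mul, ← Finset.sum_const]
  refine Finset.sum_congr rfl fun v hv => ?_
  rw [← Finset.card_filter_add_card_filter_not
    (s := Finset.univ.filter fun u => part u = 0) (fun u => D u v)]
  unfold outDeg
  congr 2
  ext u
  have h₁ := hne v u
  have h₂ := hpart v u
  have h₃ := hiff v u
  simp only [Finset.mem_filter, Finset.mem_univ, true_and] at hv ⊢
  tauto

/-- Every `s`-minimal bipartite tournament has at most `(s+1)⁴/(4s)` vertices. -/
theorem sMinimal_bipartite_card_bound (s : ℕ) (hs : 0 < s)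
    (V : Type) [Fintype V] (D : V → V → Prop) [DecidableRel D]
    (part : V → Fin 2) (hD : IsMultipartiteTournament 2 D part)
    (hmin : IsSMinimal D s) :
    (Fintype.card V : ℝ) ≤ ((s : ℝ) + 1) ^ 4 / (4 * (s : ℝ)) := by
  obtain ⟨x, hx⟩ := hD.1 0
  obtain ⟨y, hy⟩ := hD.1 1
  have hsum := hD.sum_outDeg
  simp only [hmin.outDeg_eq, Finset.sum_const, Finset.card_univ, smul_eq_mul] at hsum
  have hcard := Finset.card_filter_add_card_filter_not (s := Finset.univ) (fun v => part v = 0)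
  rw [Finset.card_univ] at hcard
  have ha : 0 < (Finset.univ.filter fun v => part v = 0).card :=
    Finset.card_pos.mpr ⟨x, by simp [hx]⟩
  have hb : 0 < (Finset.univ.filter fun v => ¬ part v = 0).card :=
    Finset.card_pos.mpr ⟨y, by simp [hy]⟩
  generalize (Finset.univ.filter fun v => part v = 0).card = a at *
  generalize (Finset.univ.filter fun v => ¬ part v = 0).card = b at *
  rw [← hcard] at hsum ⊢
  have has : s + 1 ≤ a := by
    by_contra! hle
    nlinarith [Nat.mul_le_mul_right b (Nat.le_of_lt_succ hle), Nat.mul_pos hs ha]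
  have hbs : s + 1 ≤ b := by
    by_contra! hle
    nlinarith [Nat.mul_le_mul_left a (Nat.le_of_lt_succ hle), Nat.mul_pos hs hb]
  have hs' : (0 : ℝ) < s := by exact_mod_cast hs
  have has' : (s : ℝ) + 1 ≤ a := by exact_mod_cast has
  have hbs' : (s : ℝ) + 1 ≤ b := by exact_mod_cast hbs
  have hsum' : ((a : ℝ) + b) * s = a * b := by exact_mod_cast hsum
  have hbound : (a : ℝ) + b ≤ (s + 1) ^ 2 := by
    nlinarith [mul_nonneg (sub_nonneg.mpr has') (sub_nonneg.mpr hbs')]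
  push_cast
  rw [le_div_iff₀ (by positivity)]
  calc ((a : ℝ) + b) * (4 * s) ≤ (s + 1) ^ 2 * (s + 1) ^ 2 :=
        mul_le_mul hbound (by nlinarith [sq_nonneg ((s : ℝ) - 1)]) (by positivity) (by positivity)
    _ = (s + 1) ^ 4 := by ring
end

section
/- For every positive integer s and every integer k > 2, every s-minimal k-partite tournament D satisfies |V(D)| < max{2s(s+1)², 2ks(s+1)}. -/
open Finset

namespace IsSMinimal

variable {V : Type*} [Fintype V] {D : V → V → Prop} [DecidableRel D] {s : ℕ}

/-- An `s`-minimal digraph is `s`-out-regular: otherwise an arc could be deleted. -/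
theorem outDeg_eq_s7 (h : IsSMinimal D s) (v : V) : outDeg D v = s := by
  classical
  obtain ⟨hge, -, hsub⟩ := h
  by_contra hne
  have hgt : s < outDeg D v := lt_of_le_of_ne (hge v) (Ne.symm hne)
  obtain ⟨w, hw⟩ : (univ.filter (fun w => D v w)).Nonempty :=
    Finset.card_pos.mp (lt_of_le_of_lt (Nat.zero_le s) hgt)
  have hvw : D v w := (Finset.mem_filter.mp hw).2
  obtain ⟨u, -, hu⟩ := hsub univ (fun x y => D x y ∧ ¬ (x = v ∧ y = w))
    (fun x y hxy => ⟨mem_univ x, mem_univ y, hxy.1⟩)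
    (fun hall => ((hall.2 v w).mpr hvw).2 ⟨rfl, rfl⟩) ⟨v, mem_univ v⟩
  by_cases huv : u = v
  · subst huv
    have herase : univ.filter (fun y => D u y ∧ ¬ (u = u ∧ y = w))
        = (univ.filter (fun y => D u y)).erase w := by
      ext y
      simp [and_comm]
    rw [outDeg, herase, Finset.card_erase_of_mem hw] at hu
    unfold outDeg at hgt
    omega
  · have hu' : outDeg D u < s := by simpa [outDeg, huv] using hu
    exact absurd (hge u) (not_le.mpr hu')

/-- In an `s`-minimal digraph with at least two vertices, every vertex has an in-neighbour:
otherwise it could be deleted. -/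
theorem exists_inNeighbor (h : IsSMinimal D s) {u w : V} (hwu : w ≠ u) : ∃ x, D x u := by
  classical
  obtain ⟨hge, -, hsub⟩ := h
  by_contra! hno
  obtain ⟨x, hx, hlt⟩ := hsub (univ.erase u) (fun x y => x ≠ u ∧ D x y)
    (fun x y hxy => ⟨by simp [hxy.1], by
      have hyu : y ≠ u := fun hy => hno x (hy ▸ hxy.2)
      simp [hyu], hxy.2⟩)
    (fun hall => by
      have hu := mem_univ u
      rw [← hall.1] at hu
      simp at hu)
    ⟨w, by simp [hwu]⟩
  have hxu : x ≠ u := Finset.ne_of_mem_erase hx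
  have hlt' : outDeg D x < s := by simpa [outDeg, hxu] using hlt
  exact absurd (hge x) (not_le.mpr hlt')

/-- In an `s`-minimal digraph, some vertex has in-degree at most `s`. -/
theorem exists_inDeg_le (h : IsSMinimal D s) :
    ∃ v, (univ.filter (fun u => D u v)).card ≤ s := by
  obtain ⟨v₀, -⟩ := h.2.1
  have hsum : ∑ v, (univ.filter (fun u => D u v)).card = ∑ _v : V, s := by
    rw [← Finset.sum_congr rfl fun v _ => h.outDeg_eq_s7 v]
    exact (Finset.sum_card_bipartiteAbove_eq_sum_card_bipartiteBelow D).symm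
  obtain ⟨v, -, hv⟩ := Finset.exists_le_of_sum_le ⟨v₀, mem_univ v₀⟩ hsum.le
  exact ⟨v, hv⟩

/-- An `s`-minimal multipartite tournament has at most `2s(s+1)` vertices. -/
theorem card_le {k : ℕ} {part : V → Fin k} (h : IsSMinimal D s) (hs : 0 < s)
    (hD : IsMultipartiteTournament k D part) : Fintype.card V ≤ 2 * s * (s + 1) := by
  classical
  obtain ⟨-, hne, htour⟩ := hD
  obtain ⟨v, hv⟩ := h.exists_inDeg_le
  set B := univ.filter (fun u => part u ≠ part v) with hB
  have hBcard : B.card ≤ 2 * s := by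
    have hcover : B ⊆ univ.filter (fun u => D v u) ∪ univ.filter (fun u => D u v) := by
      intro u hu
      have huv : part u ≠ part v := (Finset.mem_filter.mp hu).2
      have := htour u v huv
      simp only [mem_union, mem_filter, mem_univ, true_and]
      tauto
    have hout : (univ.filter (fun u => D v u)).card = s := h.outDeg_eq_s7 v
    have := (Finset.card_le_card hcover).trans (Finset.card_union_le _ _)
    omega
  have hPcard : (univ.filter (fun u => part u = part v)).card ≤ B.card * s := by
    refine (Finset.card_le_card ?_).trans (Finset.card_biUnion_le_card_mul B
      (fun x => univ.filter (fun u => D x u)) s fun x _ => (h.outDeg_eq_s7 x).le)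
    intro u hu
    have huv : part u = part v := (Finset.mem_filter.mp hu).2
    obtain ⟨w, hw⟩ : (univ.filter (fun w => D u w)).Nonempty :=
      Finset.card_pos.mp (hs.trans_le (h.1 u))
    have hwu : w ≠ u := by
      rintro rfl
      exact hne w w (Finset.mem_filter.mp hw).2 rfl
    obtain ⟨x, hx⟩ := h.exists_inNeighbor hwu
    simp only [mem_biUnion, mem_filter, mem_univ, true_and, hB]
    exact ⟨x, huv ▸ hne x u hx, hx⟩
  have hsplit : (univ.filter (fun u => part u = part v)).card + B.card = Fintype.card V :=
    Finset.card_filter_add_card_filter_not _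
  nlinarith

end IsSMinimal

/-- Every `s`-minimal `k`-partite tournament (`k > 2`) has fewer than
`max {2s(s+1)², 2ks(s+1)}` vertices. -/
theorem sMinimal_multipartite_card_bound (s k : ℕ) (hs : 0 < s) (hk : 2 < k)
    (V : Type) [Fintype V] (D : V → V → Prop) [DecidableRel D]
    (part : V → Fin k) (hD : IsMultipartiteTournament k D part)
    (hmin : IsSMinimal D s) :
    Fintype.card V < max (2 * s * (s + 1) ^ 2) (2 * k * s * (s + 1)) := by
  refine lt_max_of_lt_right ((hmin.card_le hs hD).trans_lt ?_)
  have hpos : 0 < 2 * s * (s + 1) := by positivity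
  calc 2 * s * (s + 1) < k * (2 * s * (s + 1)) := lt_mul_of_one_lt_left hpos (by omega)
    _ = 2 * k * s * (s + 1) := by ring
end

section
/- For every positive integer s, every s-minimal tournament is strongly connected. -/
open Finset

/-- Every `s`-minimal tournament (`s ≥ 1`) is strongly connected. -/
theorem sMinimal_tournament_strongly_connected (s : ℕ) (hs : 0 < s)
    (V : Type) [Fintype V] (T : V → V → Prop) [DecidableRel T]
    (hT : IsTournament T) (hmin : IsSMinimal T s) :
    ∀ x y : V, Relation.ReflTransGen T x y := by
  intro x y
  classical
  by_contra hxy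
  let S : Finset V := univ.filter (Relation.ReflTransGen T x)
  have hS : ∀ v, v ∈ S ↔ Relation.ReflTransGen T x v := by simp [S]
  obtain ⟨v, hv, hlt⟩ := hmin.2.2 S (fun u w => u ∈ S ∧ w ∈ S ∧ T u w) (fun _ _ h => h)
    (fun h => hxy ((hS y).1 (h.1 ▸ mem_univ y))) ⟨x, (hS x).2 .refl⟩
  refine (hmin.1 v).not_gt (lt_of_le_of_lt (card_le_card fun w hw => ?_) hlt)
  have hvw : T v w := (mem_filter.1 hw).2
  exact mem_filter.2 ⟨mem_univ w, hv, (hS w).2 (((hS v).1 hv).tail hvw), hvw⟩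
end

section
/- Let s be a positive integer and let D be an s-minimal digraph. Then for every vertex v ∈ V(D) there exists a vertex u such that uv is an arc of D and the out-degree of u in D equals exactly s. -/
open Finset

/-- In an `s`-minimal digraph, every vertex `v` has an in-neighbor `u` of out-degree
exactly `s`. -/
theorem sMinimal_in_neighbor_of_min_degree (s : ℕ) (hs : 0 < s)
    (V : Type) [Fintype V] (D : V → V → Prop) [DecidableRel D]
    (hloop : ∀ v, ¬ D v v) (hmin : IsSMinimal D s) :
    ∀ v : V, ∃ u : V, D u v ∧ outDeg D u = s := by
  classical
  obtain ⟨hdeg, -, hproper⟩ := hmin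
  intro v
  by_contra! hne
  have hsub : ∀ u w, (D u w ∧ u ≠ v ∧ w ≠ v) →
      u ∈ univ.erase v ∧ w ∈ univ.erase v ∧ D u w := by
    rintro u w ⟨h, hu, hw⟩
    simp [h, hu, hw]
  have hne_univ : univ.erase v ≠ (univ : Finset V) := fun h =>
    notMem_erase v univ (h.symm.subset (mem_univ v))
  have hnonempty : (univ.erase v).Nonempty := by
    obtain ⟨w, hw⟩ := card_pos.mp (hs.trans_le (hdeg v))
    refine ⟨w, mem_erase.mpr ⟨?_, mem_univ w⟩⟩
    rintro rfl
    exact hloop w (mem_filter.mp hw).2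
  obtain ⟨u, hu, hlt⟩ := hproper (univ.erase v) (fun u w => D u w ∧ u ≠ v ∧ w ≠ v)
    hsub (fun h => hne_univ h.1) hnonempty
  have huv : u ≠ v := ne_of_mem_erase hu
  have hout : univ.filter (fun w => D u w ∧ u ≠ v ∧ w ≠ v) =
      (univ.filter (fun w => D u w)).erase v := by
    ext w
    simp [huv, and_comm]
  have hu_deg := hdeg u
  have hu_ne := hne u
  unfold outDeg at hlt hu_deg hu_ne
  rw [hout, card_erase_eq_ite] at hlt
  split_ifs at hlt with hmem
  · have := hu_ne (mem_filter.mp hmem).2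
    omega
  · omega
end

section
/- Let t, a, b be integers with t ≥ 1, 1 ≤ a < t, and 2a + b > 2t. Then ∑_{i=0}^{t−a} C(b+1, i)·(1/2)^{b+1} > ∑_{i=0}^{t−1−a} C(b−1, i)·(1/2)^{b−1}. (That is, defining f(a, b) = ∑_{i=0}^{t−1−a} C(b−1, i)·(1/2)^{b−1}, one has f(a−1, b+2) > f(a, b) whenever a < t and 2a + b > 2t.) -/
open Finset

/-- Two applications of Pascal's rule to a partial sum of a row of binomial coefficients. -/
theorem sum_range_choose_add_two (n k : ℕ) :
    ∑ i ∈ Finset.range (k + 2), (n + 2).choose i + n.choose k =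
      4 * ∑ i ∈ Finset.range (k + 1), n.choose i + n.choose (k + 1) := by
  induction k with
  | zero =>
    simp [Finset.sum_range_succ]
    ring
  | succ k ih =>
    rw [Finset.sum_range_succ, Finset.sum_range_succ n.choose (k + 1),
      Nat.choose_succ_succ' (n + 1) (k + 1), Nat.choose_succ_succ' n k,
      Nat.choose_succ_succ' n (k + 1)]
    linarith

/-- Binomial coefficients strictly increase up to the middle of their row. -/
theorem choose_lt_choose_succ {n k : ℕ} (h : 2 * (k + 1) ≤ n) :
    n.choose k < n.choose (k + 1) := by
  have hpos : 0 < n.choose k := Nat.choose_pos (by omega)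
  have hmul := Nat.choose_succ_right_eq n k
  have hlt : k + 1 < n - k := by omega
  by_contra! hle
  nlinarith

/-- For integers `t ≥ 1`, `1 ≤ a < t`, `2a + b > 2t`:
`∑_{i=0}^{t-a} C(b+1, i) (1/2)^{b+1} > ∑_{i=0}^{t-1-a} C(b-1, i) (1/2)^{b-1}`,
i.e. `f(a-1, b+2) > f(a, b)`. -/
theorem binomial_tail_monotone (t a b : ℕ) (ha1 : 1 ≤ a) (hat : a < t)
    (hab : 2 * t < 2 * a + b) :
    (∑ i ∈ Finset.range (t - a), ((b - 1).choose i : ℚ) * (1 / 2) ^ (b - 1)) <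
    (∑ i ∈ Finset.range (t - a + 1), ((b + 1).choose i : ℚ) * (1 / 2) ^ (b + 1)) := by
  obtain ⟨k, hk⟩ : ∃ k, t - a = k + 1 := ⟨t - a - 1, by omega⟩
  obtain ⟨n, rfl⟩ : ∃ n, b = n + 1 := ⟨b - 1, by omega⟩
  have hlt : 4 * ∑ i ∈ Finset.range (k + 1), n.choose i <
      ∑ i ∈ Finset.range (k + 2), (n + 2).choose i := by
    have := sum_range_choose_add_two n k
    have := choose_lt_choose_succ (n := n) (k := k) (by omega)
    omega
  have hlt' : 4 * ∑ i ∈ Finset.range (k + 1), (n.choose i : ℚ) <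
      ∑ i ∈ Finset.range (k + 2), ((n + 2).choose i : ℚ) := by exact_mod_cast hlt
  rw [hk, ← Finset.sum_mul, ← Finset.sum_mul, Nat.add_sub_cancel]
  have hpow : (0 : ℚ) < (1 / 2) ^ (n + 2) := by positivity
  calc (∑ i ∈ Finset.range (k + 1), (n.choose i : ℚ)) * (1 / 2) ^ n
      = (4 * ∑ i ∈ Finset.range (k + 1), (n.choose i : ℚ)) * (1 / 2) ^ (n + 2) := by ring
    _ < _ := mul_lt_mul_of_pos_right hlt' hpow
end
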